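/- Assume Δ is irreducible and non-classical. If λ ∈ V is nonzero and satisfies (λ,α) ≥ 0 for all α ∈ Δ₊^c and (λ,β) ≤ 0 for all β ∈ Δ₊^nc, then there exist β', β'' ∈ Δ₊^nc such that (λ,β') < 0 and (λ,β'') = 0. -/

import Mathlib

open scoped RealInnerProductSpace

/-- A finite reduced crystallographic root system spanning a finite-dimensional
real inner product space `V`. -/
structure IsRootSystem {V : Type*} [NormedAddCommGroup V] [InnerProductSpace ℝ V]
    [FiniteDimensional ℝ V] (Δ : Set V) : Prop where
  finite : Δ.Finite
  zero_not_mem : (0 : V) ∉ Δ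
  span_eq_top : Submodule.span ℝ Δ = ⊤
  reflection_mem : ∀ α ∈ Δ, ∀ β ∈ Δ, β - (2 * ⟪β, α⟫ / ⟪α, α⟫) • α ∈ Δ
  crystallographic : ∀ α ∈ Δ, ∀ β ∈ Δ, ∃ n : ℤ, 2 * ⟪β, α⟫ / ⟪α, α⟫ = (n : ℝ)
  reduced : ∀ α ∈ Δ, ∀ c : ℝ, c • α ∈ Δ → c = 1 ∨ c = -1

/-- A partition `Δ = Δc ⊔ Δnc` into compact and noncompact roots, closed under
negation, and such that sums of roots obey the parity rules. -/
structure IsCompactDecomp {V : Type*} [NormedAddCommGroup V] [InnerProductSpace ℝ V]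
    [FiniteDimensional ℝ V] (Δ Δc Δnc : Set V) : Prop where
  union_eq : Δc ∪ Δnc = Δ
  inter_eq : Δc ∩ Δnc = ∅
  neg_c : ∀ α ∈ Δc, -α ∈ Δc
  neg_nc : ∀ α ∈ Δnc, -α ∈ Δnc
  add_cc : ∀ α ∈ Δc, ∀ β ∈ Δc, α + β ∈ Δ → α + β ∈ Δc
  add_ncnc : ∀ α ∈ Δnc, ∀ β ∈ Δnc, α + β ∈ Δ → α + β ∈ Δc
  add_cnc : ∀ α ∈ Δc, ∀ β ∈ Δnc, α + β ∈ Δ → α + β ∈ Δnc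

/-- A choice of positive roots `Δp` in the root system `Δ`. -/
structure IsPositiveSystem {V : Type*} [NormedAddCommGroup V] [InnerProductSpace ℝ V]
    [FiniteDimensional ℝ V] (Δ Δp : Set V) : Prop where
  subset : Δp ⊆ Δ
  mem_or_neg_mem : ∀ α ∈ Δ, α ∈ Δp ∨ -α ∈ Δp
  neg_not_mem : ∀ α ∈ Δp, -α ∉ Δp
  add_mem : ∀ α ∈ Δp, ∀ β ∈ Δp, α + β ∈ Δ → α + β ∈ Δp

/-- `Δ` is irreducible: it is not the union of two nonempty mutually orthogonal subsets. -/
def RootIrreducible {V : Type*} [NormedAddCommGroup V] [InnerProductSpace ℝ V]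
    [FiniteDimensional ℝ V] (Δ : Set V) : Prop :=
  ¬ ∃ Δ₁ Δ₂ : Set V, Δ₁.Nonempty ∧ Δ₂.Nonempty ∧ Δ₁ ∪ Δ₂ = Δ ∧
      ∀ α ∈ Δ₁, ∀ β ∈ Δ₂, ⟪α, β⟫ = 0

theorem IsRootSystem.ne_zero {V : Type*} [NormedAddCommGroup V] [InnerProductSpace ℝ V]
    [FiniteDimensional ℝ V] {Δ : Set V} (hRS : IsRootSystem Δ) {α : V} (hα : α ∈ Δ) : α ≠ 0 :=
  fun h => hRS.zero_not_mem (h ▸ hα)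

theorem IsRootSystem.neg_mem {V : Type*} [NormedAddCommGroup V] [InnerProductSpace ℝ V]
    [FiniteDimensional ℝ V] {Δ : Set V} (hRS : IsRootSystem Δ) {α : V} (hα : α ∈ Δ) :
    -α ∈ Δ := by
  have h := hRS.reflection_mem α hα α hα
  have h0 : ⟪α, α⟫ ≠ 0 := inner_self_ne_zero.2 (hRS.ne_zero hα)
  rw [mul_div_assoc, div_self h0] at h
  convert h using 1
  module

/-- If two distinct roots have positive inner product, their difference is a root. -/
theorem IsRootSystem.sub_mem_of_inner_pos {V : Type*} [NormedAddCommGroup V]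
    [InnerProductSpace ℝ V] [FiniteDimensional ℝ V] {Δ : Set V} (hRS : IsRootSystem Δ)
    {α β : V} (hα : α ∈ Δ) (hβ : β ∈ Δ) (hne : α ≠ β) (hpos : 0 < ⟪α, β⟫) : α - β ∈ Δ := by
  have hα0 := hRS.ne_zero hα
  have hαα : 0 < ⟪α, α⟫ := real_inner_self_pos.2 hα0
  have hββ : 0 < ⟪β, β⟫ := real_inner_self_pos.2 (hRS.ne_zero hβ)
  obtain ⟨p, hp⟩ := hRS.crystallographic β hβ α hα
  obtain ⟨q, hq⟩ := hRS.crystallographic α hα β hβ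
  have hr1 := hRS.reflection_mem β hβ α hα
  have hr2 := hRS.reflection_mem α hα β hβ
  rw [hp] at hr1
  rw [hq] at hr2
  have hlt : ⟪α, β⟫ * ⟪α, β⟫ < ⟪α, α⟫ * ⟪β, β⟫ := by
    refine lt_of_le_of_ne (real_inner_mul_inner_self_le α β) fun heq => ?_
    have habs : |⟪α, β⟫ / (‖α‖ * ‖β‖)| = 1 := by
      have hn : 0 < ‖α‖ * ‖β‖ := mul_pos (norm_pos_iff.2 hα0) (norm_pos_iff.2 (hRS.ne_zero hβ))
      rw [real_inner_self_eq_norm_sq, real_inner_self_eq_norm_sq] at heq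
      have : ⟪α, β⟫ = ‖α‖ * ‖β‖ := by nlinarith
      rw [this, div_self hn.ne', abs_one]
    obtain ⟨-, c, -, hc⟩ := (abs_real_inner_div_norm_mul_norm_eq_one_iff α β).1 habs
    rcases hRS.reduced α hα c (hc ▸ hβ) with rfl | rfl
    · exact hne (by simpa using hc.symm)
    · rw [hc, inner_smul_right] at hpos
      linarith
  rw [div_eq_iff hββ.ne'] at hp
  rw [real_inner_comm, div_eq_iff hαα.ne'] at hq
  have hp0 : (0 : ℝ) < p := by
    by_contra! h
    nlinarith
  have hq0 : (0 : ℝ) < q := by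
    by_contra! h
    nlinarith
  have hpq : (p : ℝ) * q < 4 := by
    have h4 : (p * q : ℝ) * (⟪α, α⟫ * ⟪β, β⟫) = 4 * (⟪α, β⟫ * ⟪α, β⟫) := by
      linear_combination (-2 * ⟪α, β⟫) * hq - (q * ⟪α, α⟫) * hp
    by_contra! h
    nlinarith [mul_pos hαα hββ]
  have hp0' : 0 < p := by exact_mod_cast hp0
  have hq0' : 0 < q := by exact_mod_cast hq0
  have hpq' : p * q < 4 := by exact_mod_cast hpq
  have hor : p = 1 ∨ q = 1 := by
    by_contra! h
    have h2p : 2 ≤ p := by omega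
    have h2q : 2 ≤ q := by omega
    nlinarith
  rcases hor with rfl | rfl
  · simpa using hr1
  · simpa using hRS.neg_mem hr2

/-- In an irreducible root system the noncompact roots, if there are any, span the space. -/
theorem IsCompactDecomp.span_noncompact_eq_top {V : Type*} [NormedAddCommGroup V]
    [InnerProductSpace ℝ V] [FiniteDimensional ℝ V] {Δ Δc Δnc : Set V} (hRS : IsRootSystem Δ)
    (hCD : IsCompactDecomp Δ Δc Δnc) (hirr : RootIrreducible Δ) (hne : Δnc.Nonempty) :
    Submodule.span ℝ Δnc = ⊤ := by
  have hnc : Δnc ⊆ Δ := hCD.union_eq ▸ Set.subset_union_right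
  have hc : Δc ⊆ Δ := hCD.union_eq ▸ Set.subset_union_left
  have key : ∀ α ∈ Δc, ∀ β ∈ Δnc, 0 < ⟪α, β⟫ → α ∈ Submodule.span ℝ Δnc := by
    intro α hα β hβ hpos
    have hαβ : α ≠ β := by
      rintro rfl
      exact Set.notMem_empty α (hCD.inter_eq ▸ ⟨hα, hβ⟩)
    have hsub := hRS.sub_mem_of_inner_pos (hc hα) (hnc hβ) hαβ hpos
    rw [sub_eq_add_neg] at hsub
    have hsub' := hCD.add_cnc α hα (-β) (hCD.neg_nc β hβ) hsub
    simpa using add_mem (Submodule.subset_span hsub') (Submodule.subset_span (R := ℝ) hβ)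
  have dichotomy : ∀ α ∈ Δ, (∀ β ∈ Δnc, ⟪α, β⟫ = 0) ∨ α ∈ Submodule.span ℝ Δnc := by
    intro α hα
    rw [← hCD.union_eq] at hα
    rcases hα with hα | hα
    · refine or_iff_not_imp_left.2 fun h => ?_
      push Not at h
      obtain ⟨β, hβ, h0⟩ := h
      rcases h0.lt_or_gt with h0 | h0
      · exact key α hα (-β) (hCD.neg_nc β hβ) (by rw [inner_neg_right]; linarith)
      · exact key α hα β hβ h0
    · exact Or.inr (Submodule.subset_span hα)
  have hsub : Δ ⊆ Submodule.span ℝ Δnc := by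
    intro α hα
    by_contra hαW
    obtain ⟨β, hβ⟩ := hne
    refine hirr ⟨{γ ∈ Δ | ∀ β ∈ Δnc, ⟪γ, β⟫ = 0}, {γ ∈ Δ | γ ∈ Submodule.span ℝ Δnc},
      ⟨α, hα, (dichotomy α hα).resolve_right hαW⟩, ⟨β, hnc hβ, Submodule.subset_span hβ⟩, ?_, ?_⟩
    · ext γ
      exact ⟨fun h => h.elim And.left And.left,
        fun h => (dichotomy γ h).imp (fun h' => ⟨h, h'⟩) fun h' => ⟨h, h'⟩⟩
    · rintro γ ⟨-, hγ⟩ δ ⟨-, hδ⟩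
      induction hδ using Submodule.span_induction with
      | mem x hx => exact hγ x hx
      | zero => simp
      | add x y _ _ hx hy => rw [inner_add_right, hx, hy, add_zero]
      | smul a x _ hx => rw [inner_smul_right, hx, mul_zero]
  rw [eq_top_iff, ← hRS.span_eq_top]
  exact Submodule.span_le.2 hsub

/-- If `Δ` is irreducible and non-classical and `λ ≠ 0` pairs `≥ 0` with all positive
compact roots and `≤ 0` with all positive noncompact roots, then there are positive
noncompact roots `β'`, `β''` with `(λ,β') < 0` and `(λ,β'') = 0`. -/
theorem neg_and_zero_in_noncompact {V : Type*} [NormedAddCommGroup V] [InnerProductSpace ℝ V]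
    [FiniteDimensional ℝ V] (Δ Δc Δnc Δp : Set V)
    (hRS : IsRootSystem Δ) (hCD : IsCompactDecomp Δ Δc Δnc) (hPS : IsPositiveSystem Δ Δp)
    (hirr : RootIrreducible Δ)
    (hnonclassical : ∃ β₁ ∈ Δnc ∩ Δp, ∃ β₂ ∈ Δnc ∩ Δp, β₁ + β₂ ∈ Δ)
    (lam : V) (hlam : lam ≠ 0)
    (h1 : ∀ α ∈ Δc ∩ Δp, 0 ≤ ⟪lam, α⟫)
    (h2 : ∀ β ∈ Δnc ∩ Δp, ⟪lam, β⟫ ≤ 0) :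
    (∃ β' ∈ Δnc ∩ Δp, ⟪lam, β'⟫ < 0) ∧ (∃ β'' ∈ Δnc ∩ Δp, ⟪lam, β''⟫ = 0) := by
  obtain ⟨β₁, hβ₁, β₂, hβ₂, hsum⟩ := hnonclassical
  constructor
  · by_contra! h
    have hp : ∀ β ∈ Δnc ∩ Δp, ⟪lam, β⟫ = 0 := fun β hβ => le_antisymm (h2 β hβ) (h β hβ)
    have hnc : ∀ β ∈ Δnc, ⟪lam, β⟫ = 0 := by
      intro β hβ
      rcases hPS.mem_or_neg_mem β (hCD.union_eq ▸ Or.inr hβ) with hβp | hβp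
      · exact hp β ⟨hβ, hβp⟩
      · simpa using hp (-β) ⟨hCD.neg_nc β hβ, hβp⟩
    have htop := hCD.span_noncompact_eq_top hRS hirr ⟨β₁, hβ₁.1⟩
    have hmem : lam ∈ Submodule.span ℝ Δnc := htop ▸ Submodule.mem_top
    refine hlam (inner_self_eq_zero (𝕜 := ℝ).1 ?_)
    have hall : ∀ x ∈ Submodule.span ℝ Δnc, ⟪lam, x⟫ = 0 := by
      intro x hx
      induction hx using Submodule.span_induction with
      | mem x hx => exact hnc x hx
      | zero => simp
      | add x y _ _ hx hy => rw [inner_add_right, hx, hy, add_zero]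
      | smul a x _ hx => rw [inner_smul_right, hx, mul_zero]
    exact hall lam hmem
  · have hpos := h1 (β₁ + β₂) ⟨hCD.add_ncnc β₁ hβ₁.1 β₂ hβ₂.1 hsum,
      hPS.add_mem β₁ hβ₁.2 β₂ hβ₂.2 hsum⟩
    rw [inner_add_right] at hpos
    exact ⟨β₁, hβ₁, le_antisymm (h2 β₁ hβ₁) (by linarith [h2 β₂ hβ₂])⟩
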